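/- Let (X,d) be a metric space. Suppose there exist t₀ > 1 and C > 0 such that for every s > 0 and every measure ν = Σ_{i=1}^N c_i δ_{x_i} that is a finite sum of positive multiples of Dirac deltas at points of X, the bound ‖A_{t₀,s,ν} f‖_{L¹(ν)} ≤ C‖f‖_{L¹(ν)} holds for every f ∈ L¹(ν). Then for every t > 1 there exists a constant C(t) > 0 such that for every Borel measure μ on X that is finite on bounded sets and satisfies μ(X \ supp μ) = 0, and every s > 0, the bound ‖A_{t,s,μ} f‖_{L¹(μ)} ≤ C(t)‖f‖_{L¹(μ)} holds for every f ∈ L¹(μ). -/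

import Mathlib

open MeasureTheory Metric Bornology ENNReal NNReal

/-- The support of a Borel measure: points all of whose open balls have positive measure. -/
def measSupport {X : Type*} [MetricSpace X] [MeasurableSpace X]
    (μ : Measure X) : Set X :=
  {x : X | ∀ r > 0, 0 < μ (Metric.ball x r)}

/-- The modified averaging operator
`A_{t,s,μ} f (x) = (1/μ(B(x,s))) ∫_{B(x,ts)} f dμ` (real-valued). -/
noncomputable def avgOp {X : Type*} [MetricSpace X] [MeasurableSpace X]
    (μ : Measure X) (t s : ℝ) (f : X → ℝ) (x : X) : ℝ :=
  (∫ y in Metric.closedBall x (t * s), f y ∂μ) /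
    (μ (Metric.closedBall x s)).toReal

open Set

/-- Testing the averaging operator of a sum of Dirac masses on the indicator of `y` bounds the size
of a separated subset of a ball centered at `y`. -/
lemma card_le_of_isSeparated_of_avgOp_bound {X : Type*} [MetricSpace X] [MeasurableSpace X]
    [BorelSpace X] {t₀ C s : ℝ} (hs : 0 < s)
    (h : ∀ (N : ℕ) (c : Fin N → ℝ≥0) (x : Fin N → X), (∀ i, 0 < c i) →
      ∀ ν : Measure X, ν = ∑ i : Fin N, (c i : ℝ≥0∞) • Measure.dirac (x i) →
        ∀ f : X → ℝ, Integrable f ν →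
          eLpNorm (avgOp ν t₀ s f) 1 ν ≤ ENNReal.ofReal C * eLpNorm f 1 ν)
    (y : X) (S : Finset X) (hSy : (S : Set X) ⊆ closedBall y (t₀ * s))
    (hS : IsSeparated (ENNReal.ofReal s) (S : Set X)) :
    (S.card : ℝ≥0∞) ≤ 2 * ENNReal.ofReal C := by
  classical
  set ν : Measure X := Measure.dirac y + ∑ z ∈ S, Measure.dirac z with hν
  have : IsFiniteMeasure ν := inferInstance
  have hsum : ν = ∑ i : Fin (S.card + 1), (((fun _ ↦ 1 : Fin (S.card + 1) → ℝ≥0) i : ℝ≥0) : ℝ≥0∞) •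
      Measure.dirac ((Fin.cons y (fun i ↦ (S.equivFin.symm i : X)) : Fin (S.card + 1) → X) i) := by
    simp only [ENNReal.coe_one, one_smul, Fin.sum_univ_succ, Fin.cons_zero, Fin.cons_succ, hν]
    congr 1
    rw [Equiv.sum_comp S.equivFin.symm (fun z : S ↦ Measure.dirac (z : X)),
      Finset.sum_coe_sort S (fun z ↦ Measure.dirac z)]
  set f : X → ℝ := indicator {y} 1 with hf
  have hfi : Integrable f ν := (integrable_const 1).indicator (measurableSet_singleton y)
  have hbound := h _ _ _ (fun _ ↦ one_pos) ν hsum f hfi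
  have hnorm : eLpNorm f 1 ν = ν {y} := by
    rw [eLpNorm_one_eq_lintegral_enorm, ← lintegral_indicator_one (measurableSet_singleton y)]
    refine lintegral_congr fun x ↦ ?_
    by_cases hx : x ∈ ({y} : Set X)
    · simp only [hf, indicator_of_mem hx, Pi.one_apply, enorm_one]
    · simp only [hf, indicator_of_notMem hx, enorm_zero]
  have hball : ∀ z ∈ S, ν (closedBall z s) ≤ 2 := by
    intro z hz
    have h1 : ∑ w ∈ S, Measure.dirac w (closedBall z s) ≤ 1 := by
      rw [Finset.sum_eq_single_of_mem z hz]
      · exact prob_le_one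
      · intro w hw hwz
        have : ENNReal.ofReal s < edist w z := hS hw hz hwz
        rw [edist_dist, ENNReal.ofReal_lt_ofReal_iff_of_nonneg hs.le] at this
        rw [Measure.dirac_apply' _ measurableSet_closedBall]
        simp [this]
    calc ν (closedBall z s)
        = Measure.dirac y (closedBall z s) + ∑ w ∈ S, Measure.dirac w (closedBall z s) := by
          simp [hν]
      _ ≤ 1 + 1 := add_le_add prob_le_one h1
      _ = 2 := one_add_one_eq_two
  have hball_pos : ∀ z ∈ S, 0 < ν (closedBall z s) := by
    intro z hz
    refine lt_of_lt_of_le one_pos ?_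
    calc (1 : ℝ≥0∞) = Measure.dirac z (closedBall z s) := by
          rw [Measure.dirac_apply_of_mem (mem_closedBall_self hs.le)]
      _ ≤ ∑ w ∈ S, Measure.dirac w (closedBall z s) :=
          Finset.single_le_sum (f := fun w ↦ Measure.dirac w (closedBall z s))
            (fun _ _ ↦ zero_le) hz
      _ ≤ ν (closedBall z s) := by simp [hν]
  have havg : ∀ z ∈ S, ν {y} / 2 ≤ ‖avgOp ν t₀ s f z‖ₑ := by
    intro z hz
    have hyz : {y} ⊆ closedBall z (t₀ * s) := by
      simpa [dist_comm] using hSy hz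
    have hint : ∫ x in closedBall z (t₀ * s), f x ∂ν = (ν {y}).toReal := by
      rw [hf, setIntegral_indicator (measurableSet_singleton y),
        inter_eq_self_of_subset_right hyz]
      simp [Measure.real]
    have hne : (ν (closedBall z s)).toReal ≠ 0 :=
      (ENNReal.toReal_pos (hball_pos z hz).ne' (measure_ne_top _ _)).ne'
    rw [avgOp, hint, div_eq_mul_inv (ν {y}).toReal, enorm_mul, enorm_inv hne,
      Real.enorm_of_nonneg ENNReal.toReal_nonneg, Real.enorm_of_nonneg ENNReal.toReal_nonneg,
      ENNReal.ofReal_toReal (measure_ne_top _ _), ENNReal.ofReal_toReal (measure_ne_top _ _),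
      div_eq_mul_inv]
    gcongr
    exact hball z hz
  have hlow : S.card * (ν {y} / 2) ≤ eLpNorm (avgOp ν t₀ s f) 1 ν := by
    rw [eLpNorm_one_eq_lintegral_enorm]
    calc S.card * (ν {y} / 2) = ∑ z ∈ S, ν {y} / 2 := by simp
      _ ≤ ∑ z ∈ S, ‖avgOp ν t₀ s f z‖ₑ := Finset.sum_le_sum havg
      _ = ∫⁻ x, ‖avgOp ν t₀ s f x‖ₑ ∂(∑ z ∈ S, Measure.dirac z) := by
          rw [lintegral_finsetSum_measure]
          simp
      _ ≤ ∫⁻ x, ‖avgOp ν t₀ s f x‖ₑ ∂ν := by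
          rw [hν, lintegral_add_measure]
          exact le_add_self
  have hy0 : ν {y} ≠ 0 := by
    simp [hν]
  rw [hnorm] at hbound
  have key : S.card * ν {y} ≤ (2 * ENNReal.ofReal C) * ν {y} := by
    calc S.card * ν {y} = 2 * (S.card * (ν {y} / 2)) := by
          rw [mul_left_comm, ENNReal.mul_div_cancel two_ne_zero ofNat_ne_top]
      _ ≤ 2 * (ENNReal.ofReal C * ν {y}) := by gcongr 2 * ?_; exact hlow.trans hbound
      _ = _ := (mul_assoc _ _ _).symm
  exact (ENNReal.mul_le_mul_iff_left hy0 (measure_ne_top _ _)).1 key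

/-- If separated subsets of a set have at most `M` elements, the set is covered by `M` balls. -/
lemma exists_finset_cover_of_card_isSeparated_le {X : Type*} [MetricSpace X] {s : ℝ} (hs : 0 ≤ s)
    {A : Set X} {M : ℕ}
    (h : ∀ S : Finset X, (S : Set X) ⊆ A → IsSeparated (ENNReal.ofReal s) (S : Set X) →
      S.card ≤ M) :
    ∃ F : Finset X, F.card ≤ M ∧ A ⊆ ⋃ z ∈ F, closedBall z s := by
  have hpack : packingNumber s.toNNReal A ≤ M := by
    refine iSup₂_le fun D hDA ↦ iSup_le fun hD ↦ ?_
    by_contra! hlt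
    obtain ⟨T, hTD, hT⟩ := exists_subset_encard_eq (Order.add_one_le_of_lt hlt)
    have hTfin : T.Finite := finite_of_encard_eq_coe (k := M + 1) (by simpa using hT)
    lift T to Finset X using hTfin
    have := h T (hTD.trans hDA) (hD.subset hTD)
    rw [encard_coe_eq_coe_finsetCard] at hT
    have hT' : T.card = M + 1 := by exact_mod_cast hT
    omega
  have hcov := (coveringNumber_le_packingNumber s.toNNReal A).trans hpack
  obtain ⟨F, -, hFfin, hF, hcard⟩ :=
    exists_set_encard_eq_coveringNumber (ne_top_of_le_ne_top (ENat.natCast_ne_top M) hcov)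
  lift F to Finset X using hFfin
  refine ⟨F, ?_, fun x hx ↦ ?_⟩
  · rw [← hcard, encard_coe_eq_coe_finsetCard] at hcov
    exact_mod_cast hcov
  · obtain ⟨z, hz, hxz⟩ := hF hx
    simp only [mem_iUnion₂]
    refine ⟨z, hz, ?_⟩
    have hxz' : edist x z ≤ ENNReal.ofReal s := hxz
    rwa [edist_le_ofReal hs] at hxz'

/-- Iterating a uniform covering property of balls. -/
lemma exists_finset_cover_pow {X : Type*} [MetricSpace X] {a : ℝ} (ha : 0 < a) {M : ℕ}
    (h : ∀ (y : X) (s : ℝ), 0 < s →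
      ∃ F : Finset X, F.card ≤ M ∧ closedBall y (a * s) ⊆ ⋃ z ∈ F, closedBall z s)
    (k : ℕ) (y : X) {s : ℝ} (hs : 0 < s) :
    ∃ F : Finset X, F.card ≤ M ^ k ∧ closedBall y (a ^ k * s) ⊆ ⋃ z ∈ F, closedBall z s := by
  classical
  induction k generalizing y with
  | zero => exact ⟨{y}, by simp⟩
  | succ k ih =>
    obtain ⟨F, hF, hcov⟩ := h y (a ^ k * s) (by positivity)
    choose G hG hGcov using ih
    refine ⟨F.biUnion G, ?_, ?_⟩
    · rw [pow_succ']
      exact (Finset.card_biUnion_le_card_mul _ _ _ fun z _ ↦ hG z).trans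
        (Nat.mul_le_mul_right _ hF)
    · rw [pow_succ', mul_assoc]
      refine hcov.trans (iUnion₂_subset fun z hz ↦ (hGcov z).trans ?_)
      exact biUnion_subset_biUnion_left fun w hw ↦ Finset.mem_biUnion.2 ⟨z, hz, hw⟩

/-- A metric space in which every ball is covered by finitely many balls of any given positive
radius is second countable. -/
lemma secondCountableTopology_of_finset_cover {X : Type*} [MetricSpace X]
    (h : ∀ (y : X) (r s : ℝ), 0 < s →
      ∃ F : Finset X, closedBall y r ⊆ ⋃ z ∈ F, closedBall z s) :
    SecondCountableTopology X := by
  suffices TopologicalSpace.SeparableSpace X from UniformSpace.secondCountable_of_separable X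
  rcases isEmpty_or_nonempty X with hX | ⟨⟨y⟩⟩
  · infer_instance
  rw [← TopologicalSpace.isSeparable_univ_iff, ← iUnion_closedBall_nat y]
  refine TopologicalSpace.IsSeparable.iUnion fun n ↦ TotallyBounded.isSeparable ?_
  refine Metric.totallyBounded_iff.2 fun ε hε ↦ ?_
  obtain ⟨F, hF⟩ := h y n (ε / 2) (half_pos hε)
  exact ⟨F, F.finite_toSet, hF.trans
    (iUnion₂_mono fun z _ ↦ closedBall_subset_ball (half_lt_self hε))⟩

/-- The integral of the inverse measure of balls over a set covered by half-size balls is bounded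
by the number of balls. -/
lemma setLIntegral_inv_measure_closedBall_le {X : Type*} [MetricSpace X] [MeasurableSpace X]
    [BorelSpace X] (μ : Measure X) {s : ℝ} {A : Set X} {F : Finset X}
    (hF : A ⊆ ⋃ z ∈ F, closedBall z (s / 2)) :
    ∫⁻ x in A, (μ (closedBall x s))⁻¹ ∂μ ≤ F.card := by
  have hball : ∀ z, ∫⁻ x in closedBall z (s / 2), (μ (closedBall x s))⁻¹ ∂μ ≤ 1 := by
    intro z
    calc ∫⁻ x in closedBall z (s / 2), (μ (closedBall x s))⁻¹ ∂μ
        ≤ ∫⁻ _ in closedBall z (s / 2), (μ (closedBall z (s / 2)))⁻¹ ∂μ := by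
          refine setLIntegral_mono' measurableSet_closedBall fun x hx ↦ ?_
          gcongr
          refine closedBall_subset_closedBall' ?_
          rw [mem_closedBall, dist_comm] at hx
          linarith
      _ = (μ (closedBall z (s / 2)))⁻¹ * μ (closedBall z (s / 2)) := setLIntegral_const _ _
      _ ≤ 1 := ENNReal.inv_mul_le_one _
  calc ∫⁻ x in A, (μ (closedBall x s))⁻¹ ∂μ
      ≤ ∫⁻ x in ⋃ z : F, closedBall (z : X) (s / 2), (μ (closedBall x s))⁻¹ ∂μ := by
        refine lintegral_mono_set (hF.trans ?_)
        rw [iUnion_subtype]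
    _ ≤ ∑' z : F, ∫⁻ x in closedBall (z : X) (s / 2), (μ (closedBall x s))⁻¹ ∂μ :=
        lintegral_iUnion_le _ _
    _ ≤ ∑' _ : F, 1 := ENNReal.tsum_le_tsum fun z ↦ hball z
    _ = F.card := by simp

/-- The averaging operator is dominated pointwise by its extended nonnegative version. -/
lemma enorm_avgOp_le {X : Type*} [MetricSpace X] [MeasurableSpace X] (μ : Measure X) (t s : ℝ)
    (f : X → ℝ) (x : X) :
    ‖avgOp μ t s f x‖ₑ ≤
      ∫⁻ y in closedBall x (t * s), ‖f y‖ₑ * (μ (closedBall x s))⁻¹ ∂μ := by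
  by_cases h0 : (μ (closedBall x s)).toReal = 0
  · simp [avgOp, h0]
  have hne := (ENNReal.toReal_ne_zero.1 h0)
  rw [avgOp, div_eq_mul_inv, enorm_mul, enorm_inv h0,
    Real.enorm_of_nonneg ENNReal.toReal_nonneg, ENNReal.ofReal_toReal hne.2,
    lintegral_mul_const' _ _ (ENNReal.inv_ne_top.2 hne.1)]
  gcongr
  exact enorm_integral_le_lintegral_enorm _

/-- By Tonelli, a uniform bound on the adjoint averages of the constant function bounds the
averaging operator on `L¹`. -/
lemma eLpNorm_avgOp_le {X : Type*} [MetricSpace X] [SecondCountableTopology X] [MeasurableSpace X]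
    [BorelSpace X] (μ : Measure X) [SFinite μ] {t s : ℝ} {K : ℝ≥0∞}
    (hK : ∀ y, ∫⁻ x in closedBall y (t * s), (μ (closedBall x s))⁻¹ ∂μ ≤ K)
    {f : X → ℝ} (hf : AEStronglyMeasurable f μ) :
    eLpNorm (avgOp μ t s f) 1 μ ≤ K * eLpNorm f 1 μ := by
  have hmeas : ∀ r : ℝ, MeasurableSet {p : X × X | dist p.2 p.1 ≤ r} := fun r ↦
    (isClosed_le (continuous_snd.dist continuous_fst) continuous_const).measurableSet
  have hμ : Measurable fun x ↦ μ (closedBall x s) := measurable_measure_prodMk_left (hmeas s)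
  have hjoint : AEMeasurable (Function.uncurry fun x y ↦
      (closedBall x (t * s)).indicator (fun y ↦ ‖f y‖ₑ * (μ (closedBall x s))⁻¹) y)
      (μ.prod μ) := by
    have : AEMeasurable (fun p : X × X ↦ ‖f p.2‖ₑ * (μ (closedBall p.1 s))⁻¹) (μ.prod μ) :=
      hf.comp_snd.enorm.mul (hμ.inv.comp measurable_fst).aemeasurable
    exact this.indicator (hmeas (t * s))
  simp only [eLpNorm_one_eq_lintegral_enorm]
  calc ∫⁻ x, ‖avgOp μ t s f x‖ₑ ∂μ
      ≤ ∫⁻ x, ∫⁻ y, (closedBall x (t * s)).indicator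
          (fun y ↦ ‖f y‖ₑ * (μ (closedBall x s))⁻¹) y ∂μ ∂μ := by
        refine lintegral_mono fun x ↦ ?_
        rw [lintegral_indicator measurableSet_closedBall]
        exact enorm_avgOp_le μ t s f x
    _ = ∫⁻ y, ∫⁻ x, (closedBall x (t * s)).indicator
          (fun y ↦ ‖f y‖ₑ * (μ (closedBall x s))⁻¹) y ∂μ ∂μ := lintegral_lintegral_swap hjoint
    _ = ∫⁻ y, ‖f y‖ₑ * ∫⁻ x in closedBall y (t * s), (μ (closedBall x s))⁻¹ ∂μ ∂μ := by
        refine lintegral_congr fun y ↦ ?_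
        rw [← lintegral_const_mul' _ _ enorm_ne_top,
          ← lintegral_indicator measurableSet_closedBall]
        refine lintegral_congr fun x ↦ ?_
        simp only [indicator, mem_closedBall, dist_comm]
    _ ≤ ∫⁻ y, ‖f y‖ₑ * K ∂μ := lintegral_mono fun y ↦ by gcongr; exact hK y
    _ = K * ∫⁻ y, ‖f y‖ₑ ∂μ := by
        rw [lintegral_mul_const'' _ hf.enorm, mul_comm]

lemma sigmaFinite_of_isBounded_lt_top {X : Type*} [MetricSpace X] [MeasurableSpace X]
    (μ : Measure X) (h : ∀ s : Set X, IsBounded s → μ s < ⊤) : SigmaFinite μ := by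
  rcases isEmpty_or_nonempty X with hX | ⟨⟨y⟩⟩
  · rw [Measure.eq_zero_of_isEmpty μ]
    infer_instance
  exact ⟨⟨⟨fun n : ℕ ↦ closedBall y n, fun _ ↦ trivial, fun _ ↦ h _ isBounded_closedBall,
    iUnion_closedBall_nat y⟩⟩⟩

theorem stmt11 {X : Type*} [MetricSpace X] [MeasurableSpace X] [BorelSpace X]
    (t₀ C : ℝ) (ht₀ : 1 < t₀) (hC : 0 < C)
    (h : ∀ s : ℝ, 0 < s → ∀ (N : ℕ) (c : Fin N → ℝ≥0) (x : Fin N → X),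
      (∀ i, 0 < c i) →
      ∀ ν : Measure X, ν = ∑ i : Fin N, (c i : ℝ≥0∞) • Measure.dirac (x i) →
        ∀ f : X → ℝ, Integrable f ν →
          eLpNorm (avgOp ν t₀ s f) 1 ν ≤ ENNReal.ofReal C * eLpNorm f 1 ν) :
    ∀ t : ℝ, 1 < t → ∃ C' : ℝ, 0 < C' ∧
      ∀ μ : Measure X,
        (∀ s : Set X, IsBounded s → μ s < ⊤) →
        μ (measSupport μ)ᶜ = 0 →
        ∀ s : ℝ, 0 < s →
          ∀ f : X → ℝ, Integrable f μ →
            eLpNorm (avgOp μ t s f) 1 μ ≤ ENNReal.ofReal C' * eLpNorm f 1 μ := by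
  intro t ht
  obtain ⟨k, hk⟩ := pow_unbounded_of_one_lt (2 * t) ht₀
  have hcover := exists_finset_cover_pow (X := X) (zero_lt_one.trans ht₀) (M := ⌊2 * C⌋₊)
    fun y s hs ↦ exists_finset_cover_of_card_isSeparated_le hs.le fun S hSy hS ↦ by
      have hcard := card_le_of_isSeparated_of_avgOp_bound hs (h s hs) y S hSy hS
      rw [← ENNReal.ofReal_ofNat 2, ← ENNReal.ofReal_mul two_pos.le, ← ENNReal.ofReal_natCast,
        ENNReal.ofReal_le_ofReal_iff (by positivity)] at hcard
      exact Nat.le_floor hcard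
  have : SecondCountableTopology X := by
    refine secondCountableTopology_of_finset_cover fun y r s hs ↦ ?_
    obtain ⟨n, hn⟩ := pow_unbounded_of_one_lt (r / s) ht₀
    obtain ⟨F, -, hF⟩ := hcover n y hs
    exact ⟨F, (closedBall_subset_closedBall ((div_lt_iff₀ hs).1 hn).le).trans hF⟩
  refine ⟨(⌊2 * C⌋₊ ^ k : ℕ) + 1, by positivity, fun μ hμ _ s hs f hf ↦ ?_⟩
  have := sigmaFinite_of_isBounded_lt_top μ hμ
  refine eLpNorm_avgOp_le μ (fun y ↦ ?_) hf.aestronglyMeasurable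
  obtain ⟨F, hcard, hF⟩ := hcover k y (half_pos hs)
  have hsub : closedBall y (t * s) ⊆ closedBall y (t₀ ^ k * (s / 2)) :=
    closedBall_subset_closedBall (by nlinarith)
  refine (setLIntegral_inv_measure_closedBall_le μ (hsub.trans hF)).trans ?_
  rw [← ENNReal.ofReal_natCast]
  refine ENNReal.ofReal_le_ofReal ?_
  have : (F.card : ℝ) ≤ (⌊2 * C⌋₊ ^ k : ℕ) := by exact_mod_cast hcard
  linarith
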